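/- Negative entropy is 1-strongly convex with respect to the ℓ1 norm on the probability simplex: if p, q are elements of ℝ^n with p_i > 0 and q_i >= 0 for all i, sum_i p_i = 1 and sum_i q_i = 1, then sum_i q_i·log q_i >= sum_i p_i·log p_i + sum_i (log p_i + 1)·(q_i − p_i) + (1/2)·( sum_i |p_i − q_i| )², with the convention 0·log 0 = 0. -/

import Mathlib

open Finset

lemma pinsker_hasDeriv (x : ℝ) (hx : 0 < x) :
    HasDerivAt (fun x : ℝ => Real.log x - (5 * x ^ 2 - 4 * x - 1) / (2 * x ^ 2 + 4 * x))
      ((x - 1) ^ 3 / (x ^ 2 * (x + 2) ^ 2)) x := by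
  have hne : 2 * x ^ 2 + 4 * x ≠ 0 := by positivity
  have h1 : HasDerivAt (fun x : ℝ => 5 * x ^ 2 - 4 * x - 1) (10 * x - 4) x := by
    have := ((((hasDerivAt_id x).pow 2).const_mul 5).sub
      ((hasDerivAt_id x).const_mul 4)).sub_const 1
    refine this.congr_deriv ?_
    simp; ring
  have h2 : HasDerivAt (fun x : ℝ => 2 * x ^ 2 + 4 * x) (4 * x + 4) x := by
    have := (((hasDerivAt_id x).pow 2).const_mul 2).add ((hasDerivAt_id x).const_mul 4)
    refine this.congr_deriv ?_
    simp; ring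
  refine ((Real.hasDerivAt_log hx.ne').sub (h1.div h2 hne)).congr_deriv ?_
  have : x + 2 ≠ 0 := by positivity
  have e : 2 * x ^ 2 + 4 * x = 2 * x * (x + 2) := by ring
  rw [e]
  field_simp
  ring

lemma pinsker_log (x : ℝ) (hx : 0 < x) :
    (5 * x ^ 2 - 4 * x - 1) / (2 * x ^ 2 + 4 * x) ≤ Real.log x := by
  rw [← sub_nonneg]
  rcases le_total x 1 with h | h
  · have := antitoneOn_of_deriv_nonpos (convex_Icc x 1)
      (fun y hy => (pinsker_hasDeriv y (hx.trans_le hy.1)).continuousAt.continuousWithinAt)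
      (fun y hy => by
        rw [interior_Icc] at hy
        exact (pinsker_hasDeriv y (hx.trans hy.1)).differentiableAt.differentiableWithinAt)
      (fun y hy => by
        rw [interior_Icc] at hy
        rw [(pinsker_hasDeriv y (hx.trans hy.1)).deriv]
        exact div_nonpos_of_nonpos_of_nonneg
          (Odd.pow_nonpos (by decide) (by linarith [hy.2])) (by positivity))
      (Set.left_mem_Icc.2 h) (Set.right_mem_Icc.2 h) h
    norm_num at this ⊢
    linarith
  · have := monotoneOn_of_deriv_nonneg (convex_Icc 1 x)
      (fun y hy => (pinsker_hasDeriv y (one_pos.trans_le hy.1)).continuousAt.continuousWithinAt)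
      (fun y hy => by
        rw [interior_Icc] at hy
        exact (pinsker_hasDeriv y (one_pos.trans hy.1)).differentiableAt.differentiableWithinAt)
      (fun y hy => by
        rw [interior_Icc] at hy
        rw [(pinsker_hasDeriv y (one_pos.trans hy.1)).deriv]
        have : 0 ≤ y - 1 := by linarith [hy.1]
        positivity)
      (Set.left_mem_Icc.2 h) (Set.right_mem_Icc.2 h) h
    norm_num at this ⊢
    linarith

lemma pinsker_term (p q : ℝ) (hp : 0 < p) (hq : 0 ≤ q) :
    3 * (p - q) ^ 2 ≤ (2 * q + 4 * p) * (q * Real.log q - q * Real.log p - q + p) := by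
  rcases hq.eq_or_lt with rfl | hq
  · simp; nlinarith
  · have h := pinsker_log (q / p) (by positivity)
    rw [Real.log_div hq.ne' hp.ne'] at h
    have e : (5 * (q / p) ^ 2 - 4 * (q / p) - 1) / (2 * (q / p) ^ 2 + 4 * (q / p))
        = (5 * q ^ 2 - 4 * q * p - p ^ 2) / (q * (2 * q + 4 * p)) := by
      field_simp
    rw [e, div_le_iff₀ (by positivity)] at h
    nlinarith




/-- Negative entropy is 1-strongly convex with respect to the ℓ1 norm on the probability
simplex: for probability vectors `p` (strictly positive) and `q` (nonnegative) in `ℝ^n`,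
`∑ q_i·log q_i ≥ ∑ p_i·log p_i + ∑ (log p_i + 1)·(q_i − p_i) + (1/2)·(∑ |p_i − q_i|)²`
(the convention `0·log 0 = 0` is automatic since `Real.log 0 = 0`). -/
theorem stmt9 (n : ℕ) (hn : 0 < n) (p q : Fin n → ℝ)
    (hp : ∀ i, 0 < p i) (hq : ∀ i, 0 ≤ q i)
    (hps : ∑ i, p i = 1) (hqs : ∑ i, q i = 1) :
    ∑ i, p i * Real.log (p i) + ∑ i, (Real.log (p i) + 1) * (q i - p i) +
        (1 / 2) * (∑ i, |p i - q i|) ^ 2 ≤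
      ∑ i, q i * Real.log (q i) := by
  have key : (∑ i, |p i - q i|) ^ 2 ≤ (∑ i, (2 * q i + 4 * p i)) *
      ∑ i, (q i * Real.log (q i) - q i * Real.log (p i) - q i + p i) / 3 := by
    have hw : ∀ i, 0 < 2 * q i + 4 * p i := fun i => by linarith [hp i, hq i]
    have ht : ∀ i, (p i - q i) ^ 2 ≤ (2 * q i + 4 * p i) *
        ((q i * Real.log (q i) - q i * Real.log (p i) - q i + p i) / 3) := fun i => by
      linarith [pinsker_term (p i) (q i) (hp i) (hq i)]
    have hk : ∀ i, 0 ≤ (q i * Real.log (q i) - q i * Real.log (p i) - q i + p i) / 3 :=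
      fun i => nonneg_of_mul_nonneg_right ((sq_nonneg _).trans (ht i)) (hw i)
    exact Finset.sum_sq_le_sum_mul_sum_of_sq_le_mul _ (fun i _ => (hw i).le) (fun i _ => hk i)
      (fun i _ => by rw [sq_abs]; exact ht i)
  have h6 : ∑ i, (2 * q i + 4 * p i) = 6 := by
    rw [Finset.sum_add_distrib, ← Finset.mul_sum, ← Finset.mul_sum, hps, hqs]; norm_num
  have e : ∑ i, p i * Real.log (p i) + ∑ i, (Real.log (p i) + 1) * (q i - p i) +
      ∑ i, (q i * Real.log (q i) - q i * Real.log (p i) - q i + p i)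
      = ∑ i, q i * Real.log (q i) := by
    rw [← Finset.sum_add_distrib, ← Finset.sum_add_distrib]
    exact Finset.sum_congr rfl fun i _ => by ring
  rw [h6, ← Finset.sum_div] at key
  linarith
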